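/- arXiv:1405.4371 — 9 statements merged into one kernel-verified Lean document; each statement's English description precedes it below -/
import Mathlib

section
/- Let (E_k)_{k≥0} be a family of real inner product spaces. Suppose given vectors g_k ∈ E_k, η_k ∈ E_k and τ_k ∈ E_{k+1} (τ_k representing the scaled vector transport of η_k) and real numbers β_k (k ≥ 1) such that for every k ≥ 1: β_k = ‖g_k‖² / (⟨g_k, τ_{k-1}⟩ − ⟨g_{k-1}, η_{k-1}⟩) with ⟨g_k, τ_{k-1}⟩ − ⟨g_{k-1}, η_{k-1}⟩ ≠ 0, and η_k = −g_k + β_k τ_{k-1}. If moreover ⟨g_k, η_k⟩ ≠ 0 for all k ≥ 0, then for every k ≥ 1, β_k = ⟨g_k, η_k⟩ / ⟨g_{k-1}, η_{k-1}⟩. -/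
open RealInnerProductSpace

/-- Proposition 3.1: the Dai–Yuan-type parameter β̌ defined via the transported
direction satisfies the ratio formula β̌_k = ⟪g_k, η_k⟫ / ⟪g_{k-1}, η_{k-1}⟫. -/
theorem riemannian_dai_yuan_beta_ratio
    {E : ℕ → Type*} [∀ k, NormedAddCommGroup (E k)] [∀ k, InnerProductSpace ℝ (E k)]
    (g η : ∀ k, E k) (τ : ∀ k, E (k + 1)) (β : ℕ → ℝ)
    (hden : ∀ k, ⟪g (k + 1), τ k⟫ - ⟪g k, η k⟫ ≠ 0)
    (hβ : ∀ k, β (k + 1) = ‖g (k + 1)‖ ^ 2 / (⟪g (k + 1), τ k⟫ - ⟪g k, η k⟫))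
    (hη : ∀ k, η (k + 1) = -g (k + 1) + β (k + 1) • τ k)
    (hgη : ∀ k, ⟪g k, η k⟫ ≠ 0) :
    ∀ k, β (k + 1) = ⟪g (k + 1), η (k + 1)⟫ / ⟪g k, η k⟫ := by
  intro k
  have hmul : β (k + 1) * (⟪g (k + 1), τ k⟫ - ⟪g k, η k⟫) = ‖g (k + 1)‖ ^ 2 := by
    rw [hβ k, div_mul_cancel₀ _ (hden k)]
  rw [eq_div_iff (hgη k), hη k, inner_add_right, inner_neg_right, real_inner_smul_right,
    real_inner_self_eq_norm_sq]
  linarith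
end

section
/- Let E be a real Hilbert space and f : E → ℝ a differentiable function that is bounded below and satisfies |⟨∇f(x + tη) − ∇f(x), η⟩| ≤ L t for some constant L > 0, for all x ∈ E, all unit vectors η ∈ E, and all t ≥ 0. Let 0 < c₁ < c₂ < 1 and let (x_k), (η_k), (α_k) be sequences with η_k ≠ 0, ⟨∇f(x_k), η_k⟩ < 0, α_k > 0, x_{k+1} = x_k + α_k η_k, and suppose each α_k satisfies the weak Wolfe conditions: f(x_k + α_k η_k) ≤ f(x_k) + c₁ α_k ⟨∇f(x_k), η_k⟩ and ⟨∇f(x_k + α_k η_k), η_k⟩ ≥ c₂ ⟨∇f(x_k), η_k⟩. Then the series ∑_{k=0}^∞ ⟨∇f(x_k), η_k⟩² / ‖η_k‖² converges. -/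
open RealInnerProductSpace

/-- A nonnegative sequence dominated by the decrements of a sequence that is bounded below is
summable. -/
theorem summable_of_nonneg_of_le_sub_succ {a u : ℕ → ℝ} (ha : ∀ k, 0 ≤ a k)
    (hau : ∀ k, a k ≤ u k - u (k + 1)) (hu : BddBelow (Set.range u)) : Summable a := by
  obtain ⟨m, hm⟩ := hu
  refine summable_of_sum_range_le (c := u 0 - m) ha fun n => ?_
  calc ∑ k ∈ Finset.range n, a k
      ≤ ∑ k ∈ Finset.range n, (u k - u (k + 1)) := Finset.sum_le_sum fun k _ => hau k
    _ = u 0 - u n := Finset.sum_range_sub' u n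
    _ ≤ u 0 - m := sub_le_sub_left (hm ⟨n, rfl⟩) _

/-- A Lipschitz bound along unit directions, rescaled to an arbitrary nonzero direction. -/
theorem inner_sub_le_of_unit_directional_lipschitz
    {E : Type*} [NormedAddCommGroup E] [InnerProductSpace ℝ E] {G : E → E} {L : ℝ}
    (hG : ∀ (x v : E) (t : ℝ), ‖v‖ = 1 → 0 ≤ t → |⟪G (x + t • v) - G x, v⟫| ≤ L * t)
    (x : E) {v : E} (hv : v ≠ 0) {t : ℝ} (ht : 0 ≤ t) :
    ⟪G (x + t • v) - G x, v⟫ ≤ L * t * ‖v‖ ^ 2 := by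
  have hpos : 0 < ‖v‖ := norm_pos_iff.mpr hv
  have h := (le_abs_self _).trans
    (hG x (‖v‖⁻¹ • v) (t * ‖v‖) (norm_smul_inv_norm (𝕜 := ℝ) hv) (by positivity))
  rw [smul_smul, mul_inv_cancel_right₀ hpos.ne', real_inner_smul_right,
    inv_mul_le_iff₀ hpos] at h
  linarith

/-- Zoutendijk's theorem in the Euclidean (Hilbert space) case: under the weak
Wolfe conditions and a directional Lipschitz assumption on the gradient, the
series ∑ ⟪∇f(x_k), η_k⟫² / ‖η_k‖² converges. -/
theorem zoutendijk_euclidean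
    {E : Type*} [NormedAddCommGroup E] [InnerProductSpace ℝ E] [CompleteSpace E]
    (f : E → ℝ) (hf : Differentiable ℝ f)
    (hbdd : BddBelow (Set.range f))
    (L : ℝ) (hL : 0 < L)
    (hLip : ∀ (x : E) (η : E) (t : ℝ), ‖η‖ = 1 → 0 ≤ t →
      |⟪gradient f (x + t • η) - gradient f x, η⟫| ≤ L * t)
    (c₁ c₂ : ℝ) (hc₁ : 0 < c₁) (hc₁c₂ : c₁ < c₂) (hc₂ : c₂ < 1)
    (x η : ℕ → E) (α : ℕ → ℝ)
    (hη : ∀ k, η k ≠ 0)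
    (hdescent : ∀ k, ⟪gradient f (x k), η k⟫ < 0)
    (hα : ∀ k, 0 < α k)
    (hupdate : ∀ k, x (k + 1) = x k + α k • η k)
    (hwolfe1 : ∀ k, f (x k + α k • η k) ≤ f (x k) + c₁ * α k * ⟪gradient f (x k), η k⟫)
    (hwolfe2 : ∀ k, ⟪gradient f (x k + α k • η k), η k⟫ ≥ c₂ * ⟪gradient f (x k), η k⟫) :
    Summable (fun k => ⟪gradient f (x k), η k⟫ ^ 2 / ‖η k‖ ^ 2) := by
  have hC : 0 < c₁ * (1 - c₂) / L := div_pos (mul_pos hc₁ (sub_pos.mpr hc₂)) hL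
  refine (summable_mul_left_iff hC.ne').mp
    (summable_of_nonneg_of_le_sub_succ (u := fun k => f (x k)) (fun k => by positivity)
      (fun k => ?_) (hbdd.mono (Set.range_comp_subset_range x f)))
  have hη_pos : 0 < ‖η k‖ := norm_pos_iff.mpr (hη k)
  have hstep := inner_sub_le_of_unit_directional_lipschitz hLip (x k) (hη k) (hα k).le
  rw [inner_sub_left] at hstep
  have hcurv := hwolfe2 k
  have hdec := hwolfe1 k
  have hneg := hdescent k
  rw [← hupdate k] at hstep hcurv hdec
  set g := ⟪gradient f (x k), η k⟫
  have hlower : (1 - c₂) * -g ≤ L * α k * ‖η k‖ ^ 2 := by linarith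
  calc c₁ * (1 - c₂) / L * (g ^ 2 / ‖η k‖ ^ 2)
      = c₁ * -g * ((1 - c₂) * -g) / (L * ‖η k‖ ^ 2) := by field_simp
    _ ≤ c₁ * -g * (L * α k * ‖η k‖ ^ 2) / (L * ‖η k‖ ^ 2) := by
        have : 0 ≤ c₁ * -g := mul_nonneg hc₁.le (neg_nonneg.mpr hneg.le)
        gcongr
    _ = -(c₁ * α k * g) := by field_simp
    _ ≤ f (x k) - f (x (k + 1)) := by linarith
end

section
/- Let E and F be real inner product spaces, let 0 < c₂ < 1, let g, η ∈ E with ⟨g, η⟩ < 0, and let g', u ∈ F with ⟨g', u⟩ ≥ c₂ ⟨g, η⟩. Define τ = u if ‖u‖ ≤ ‖η‖ and τ = (‖η‖/‖u‖) u otherwise. Then ⟨g', τ⟩ > ⟨g, η⟩. -/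
open RealInnerProductSpace

/-- With the scaled vector transport, the curvature condition yields the strict
inequality ⟪g', τ⟫ > ⟪g, η⟫. -/
theorem scaled_transport_curvature_strict
    {E F : Type*} [NormedAddCommGroup E] [InnerProductSpace ℝ E]
    [NormedAddCommGroup F] [InnerProductSpace ℝ F]
    (c₂ : ℝ) (hc₂0 : 0 < c₂) (hc₂1 : c₂ < 1)
    (g η : E) (hgη : ⟪g, η⟫ < 0)
    (g' u : F) (hcurv : ⟪g', u⟫ ≥ c₂ * ⟪g, η⟫)
    (τ : F) (hτ : τ = if ‖u‖ ≤ ‖η‖ then u else (‖η‖ / ‖u‖) • u) :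
    ⟪g', τ⟫ > ⟪g, η⟫ := by
  have hlt : c₂ * ⟪g, η⟫ > ⟪g, η⟫ := by nlinarith
  subst hτ
  split_ifs with h
  · linarith
  · have hr0 : 0 ≤ ‖η‖ / ‖u‖ := by positivity
    have hr1 : ‖η‖ / ‖u‖ ≤ 1 := div_le_one_of_le₀ (not_le.mp h).le (norm_nonneg u)
    have hneg : c₂ * ⟪g, η⟫ ≤ 0 := (mul_neg_of_pos_of_neg hc₂0 hgη).le
    rw [real_inner_smul_right]
    calc ‖η‖ / ‖u‖ * ⟪g', u⟫ ≥ ‖η‖ / ‖u‖ * (c₂ * ⟪g, η⟫) :=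
          mul_le_mul_of_nonneg_left hcurv hr0
      _ ≥ c₂ * ⟪g, η⟫ := by nlinarith
      _ > ⟪g, η⟫ := hlt
end

section
/- Let E and F be real inner product spaces, g, η ∈ E with ⟨g, η⟩ < 0, g' ∈ F with g' ≠ 0, and τ ∈ F with ⟨g', τ⟩ > ⟨g, η⟩. Define β = ‖g'‖² / (⟨g', τ⟩ − ⟨g, η⟩) and η' = −g' + β τ. Then ⟨g', η'⟩ = ‖g'‖² ⟨g, η⟩ / (⟨g', τ⟩ − ⟨g, η⟩); in particular ⟨g', η'⟩ < 0 and β > 0. -/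
open RealInnerProductSpace

/-- The inductive step of Proposition 4.2: the next search direction is a
descent direction and β is positive. -/
theorem dai_yuan_descent_step
    {E F : Type*} [NormedAddCommGroup E] [InnerProductSpace ℝ E]
    [NormedAddCommGroup F] [InnerProductSpace ℝ F]
    (g η : E) (hgη : ⟪g, η⟫ < 0)
    (g' : F) (hg' : g' ≠ 0)
    (τ : F) (hτ : ⟪g', τ⟫ > ⟪g, η⟫)
    (β : ℝ) (hβ : β = ‖g'‖ ^ 2 / (⟪g', τ⟫ - ⟪g, η⟫))
    (η' : F) (hη' : η' = -g' + β • τ) :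
    ⟪g', η'⟫ = ‖g'‖ ^ 2 * ⟪g, η⟫ / (⟪g', τ⟫ - ⟪g, η⟫) ∧ ⟪g', η'⟫ < 0 ∧ β > 0 := by
  have hd : 0 < ⟪g', τ⟫ - ⟪g, η⟫ := sub_pos.mpr hτ
  have hn : 0 < ‖g'‖ ^ 2 := pow_pos (norm_pos_iff.mpr hg') 2
  have key : ⟪g', η'⟫ = ‖g'‖ ^ 2 * ⟪g, η⟫ / (⟪g', τ⟫ - ⟪g, η⟫) := by
    rw [hη', hβ, inner_add_right, inner_neg_right, inner_smul_right,
      real_inner_self_eq_norm_sq]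
    field_simp
    ring
  refine ⟨key, ?_, ?_⟩
  · rw [key]
    exact div_neg_of_neg_of_pos (mul_neg_of_pos_of_neg hn hgη) hd
  · rw [hβ]
    exact div_pos hn hd
end

section
/- Let (E_k)_{k≥0} be a family of real inner product spaces and let 0 < c₂ < 1. Suppose given g_k ∈ E_k with g_k ≠ 0 for all k, u_k ∈ E_{k+1}, and sequences η_k ∈ E_k, τ_k ∈ E_{k+1}, β_k ∈ ℝ defined recursively by: η_0 = −g_0; τ_k = u_k if ‖u_k‖ ≤ ‖η_k‖ and τ_k = (‖η_k‖/‖u_k‖)u_k otherwise; β_{k+1} = ‖g_{k+1}‖² / (⟨g_{k+1}, τ_k⟩ − ⟨g_k, η_k⟩); η_{k+1} = −g_{k+1} + β_{k+1} τ_k. Assume that for every k the curvature condition ⟨g_{k+1}, u_k⟩ ≥ c₂ ⟨g_k, η_k⟩ holds. Then for all k ≥ 0: ⟨g_k, η_k⟩ < 0 and ⟨g_k, η_k⟩ < ⟨g_{k+1}, τ_k⟩ (so in particular every denominator ⟨g_{k+1}, τ_k⟩ − ⟨g_k, η_k⟩ is strictly positive and the recursion is well defined). -/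
open RealInnerProductSpace

/-- Proposition 4.2: the scaled Dai–Yuan-type Riemannian conjugate gradient
method generates descent directions, and all denominators are positive. -/
theorem scaled_dai_yuan_descent
    {E : ℕ → Type*} [∀ k, NormedAddCommGroup (E k)] [∀ k, InnerProductSpace ℝ (E k)]
    (c₂ : ℝ) (hc₂0 : 0 < c₂) (hc₂1 : c₂ < 1)
    (g : ∀ k, E k) (hg : ∀ k, g k ≠ 0)
    (u : ∀ k, E (k + 1)) (η : ∀ k, E k) (τ : ∀ k, E (k + 1)) (β : ℕ → ℝ)
    (hη0 : η 0 = -g 0)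
    (hτ : ∀ k, τ k = if ‖u k‖ ≤ ‖η k‖ then u k else (‖η k‖ / ‖u k‖) • u k)
    (hβ : ∀ k, β (k + 1) = ‖g (k + 1)‖ ^ 2 / (⟪g (k + 1), τ k⟫ - ⟪g k, η k⟫))
    (hη : ∀ k, η (k + 1) = -g (k + 1) + β (k + 1) • τ k)
    (hcurv : ∀ k, ⟪g (k + 1), u k⟫ ≥ c₂ * ⟪g k, η k⟫) :
    ∀ k, ⟪g k, η k⟫ < 0 ∧ ⟪g k, η k⟫ < ⟪g (k + 1), τ k⟫ := by
  have step : ∀ k, ⟪g k, η k⟫ < 0 → ⟪g k, η k⟫ < ⟪g (k + 1), τ k⟫ := by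
    intro k hk
    obtain ⟨s, hs0, hs1, hs⟩ : ∃ s : ℝ, 0 ≤ s ∧ s ≤ 1 ∧ τ k = s • u k := by
      by_cases h : ‖u k‖ ≤ ‖η k‖
      · exact ⟨1, zero_le_one, le_rfl, by rw [hτ, if_pos h, one_smul]⟩
      · exact ⟨‖η k‖ / ‖u k‖, by positivity,
          div_le_one_of_le₀ (not_le.mp h).le (norm_nonneg _), by rw [hτ, if_neg h]⟩
    rw [hs, real_inner_smul_right]
    have hsc : s * c₂ < 1 := (mul_le_of_le_one_left hc₂0.le hs1).trans_lt hc₂1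
    calc ⟪g k, η k⟫ < s * c₂ * ⟪g k, η k⟫ := by nlinarith
      _ = s * (c₂ * ⟪g k, η k⟫) := mul_assoc _ _ _
      _ ≤ s * ⟪g (k + 1), u k⟫ := mul_le_mul_of_nonneg_left (hcurv k) hs0
  have descent : ∀ k, ⟪g k, η k⟫ < 0 := by
    intro k
    induction k with
    | zero =>
      rw [hη0, inner_neg_right, neg_lt_zero]
      exact real_inner_self_pos.mpr (hg 0)
    | succ k ih =>
      have hd : 0 < ⟪g (k + 1), τ k⟫ - ⟪g k, η k⟫ := sub_pos.mpr (step k ih)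
      have hg' : 0 < ‖g (k + 1)‖ := norm_pos_iff.mpr (hg (k + 1))
      have key : ⟪g (k + 1), η (k + 1)⟫ =
          ‖g (k + 1)‖ ^ 2 * ⟪g k, η k⟫ / (⟪g (k + 1), τ k⟫ - ⟪g k, η k⟫) := by
        rw [hη, inner_add_right, inner_neg_right, real_inner_smul_right,
          real_inner_self_eq_norm_sq, hβ]
        field_simp
        ring
      rw [key]
      exact div_neg_of_neg_of_pos (mul_neg_of_pos_of_neg (by positivity) ih) hd
  exact fun k => ⟨descent k, step k (descent k)⟩
end

section
/- Under the hypotheses of Proposition 4.2 — (E_k)_{k≥0} real inner product spaces, 0 < c₂ < 1, g_k ∈ E_k nonzero, u_k ∈ E_{k+1} with ⟨g_{k+1}, u_k⟩ ≥ c₂⟨g_k, η_k⟩, η_0 = −g_0, τ_k = min{1, ‖η_k‖/‖u_k‖}·u_k, β_{k+1} = ‖g_{k+1}‖²/(⟨g_{k+1}, τ_k⟩ − ⟨g_k, η_k⟩), η_{k+1} = −g_{k+1} + β_{k+1}τ_k — it holds that β_k > 0 for all k ≥ 1. -/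
open RealInnerProductSpace

/-- Corollary to Proposition 4.2: the Dai–Yuan-type parameters β_k are
positive for all k ≥ 1. -/
theorem scaled_dai_yuan_beta_pos
    {E : ℕ → Type*} [∀ k, NormedAddCommGroup (E k)] [∀ k, InnerProductSpace ℝ (E k)]
    (c₂ : ℝ) (hc₂0 : 0 < c₂) (hc₂1 : c₂ < 1)
    (g : ∀ k, E k) (hg : ∀ k, g k ≠ 0)
    (u : ∀ k, E (k + 1)) (η : ∀ k, E k) (τ : ∀ k, E (k + 1)) (β : ℕ → ℝ)
    (hη0 : η 0 = -g 0)
    (hτ : ∀ k, τ k = min 1 (‖η k‖ / ‖u k‖) • u k)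
    (hβ : ∀ k, β (k + 1) = ‖g (k + 1)‖ ^ 2 / (⟪g (k + 1), τ k⟫ - ⟪g k, η k⟫))
    (hη : ∀ k, η (k + 1) = -g (k + 1) + β (k + 1) • τ k)
    (hcurv : ∀ k, ⟪g (k + 1), u k⟫ ≥ c₂ * ⟪g k, η k⟫) :
    ∀ k ≥ 1, β k > 0 := by
  have hden : ∀ k, ⟪g k, η k⟫ < 0 → 0 < ⟪g (k + 1), τ k⟫ - ⟪g k, η k⟫ := by
    intro k hk
    rw [hτ k, real_inner_smul_right]
    have h0 : 0 ≤ min 1 (‖η k‖ / ‖u k‖) := by positivity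
    have h1 : min 1 (‖η k‖ / ‖u k‖) ≤ 1 := min_le_left _ _
    generalize min 1 (‖η k‖ / ‖u k‖) = s at h0 h1
    have hsc : s * c₂ < 1 := by nlinarith
    nlinarith [mul_le_mul_of_nonneg_left (hcurv k) h0]
  have hpos : ∀ k, ⟪g k, η k⟫ < 0 → 0 < β (k + 1) := by
    intro k hk
    rw [hβ k]
    exact div_pos (pow_pos (norm_pos_iff.mpr (hg (k + 1))) 2) (hden k hk)
  have hdesc : ∀ k, ⟪g k, η k⟫ < 0 := by
    intro k
    induction k with
    | zero =>
      rw [hη0, inner_neg_right, real_inner_self_eq_norm_sq]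
      exact neg_neg_of_pos (pow_pos (norm_pos_iff.mpr (hg 0)) 2)
    | succ k ih =>
      have hmul := (eq_div_iff (hden k ih).ne').mp (hβ k)
      rw [hη k, inner_add_right, inner_neg_right, real_inner_smul_right,
        real_inner_self_eq_norm_sq]
      nlinarith [mul_neg_of_pos_of_neg (hpos k ih) ih]
  intro k hk
  obtain ⟨m, rfl⟩ := Nat.exists_eq_add_of_le' hk
  exact hpos m (hdesc m)
end

section
/- Let E and F be real inner product spaces, g, η ∈ E with ⟨g, η⟩ < 0, g' ∈ F with g' ≠ 0, and τ ∈ F with ‖τ‖ ≤ ‖η‖ and ⟨g', τ⟩ > ⟨g, η⟩. Define β = ‖g'‖² / (⟨g', τ⟩ − ⟨g, η⟩) and η' = −g' + β τ. Then ‖η'‖² / ⟨g', η'⟩² ≤ ‖η‖² / ⟨g, η⟩² + 1 / ‖g'‖². -/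
open RealInnerProductSpace

/-- The key one-step inequality in the global convergence proof:
‖η'‖²/⟪g',η'⟫² ≤ ‖η‖²/⟪g,η⟫² + 1/‖g'‖². -/
theorem dai_yuan_one_step_inequality
    {E F : Type*} [NormedAddCommGroup E] [InnerProductSpace ℝ E]
    [NormedAddCommGroup F] [InnerProductSpace ℝ F]
    (g η : E) (hgη : ⟪g, η⟫ < 0)
    (g' : F) (hg' : g' ≠ 0)
    (τ : F) (hτnorm : ‖τ‖ ≤ ‖η‖) (hτ : ⟪g', τ⟫ > ⟪g, η⟫)
    (β : ℝ) (hβ : β = ‖g'‖ ^ 2 / (⟪g', τ⟫ - ⟪g, η⟫))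
    (η' : F) (hη' : η' = -g' + β • τ) :
    ‖η'‖ ^ 2 / ⟪g', η'⟫ ^ 2 ≤ ‖η‖ ^ 2 / ⟪g, η⟫ ^ 2 + 1 / ‖g'‖ ^ 2 := by
  have hinner : ⟪g', η'⟫ = -‖g'‖ ^ 2 + β * ⟪g', τ⟫ := by
    rw [hη', inner_add_right, inner_neg_right, inner_smul_right, real_inner_self_eq_norm_sq]
  have hnorm : ‖η'‖ ^ 2 = ‖g'‖ ^ 2 - 2 * β * ⟪g', τ⟫ + β ^ 2 * ‖τ‖ ^ 2 := by
    rw [hη', norm_add_sq_real, norm_neg, inner_neg_left, inner_smul_right, norm_smul, mul_pow,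
      Real.norm_eq_abs, sq_abs]
    ring
  have hG : ‖g'‖ ≠ 0 := norm_ne_zero_iff.mpr hg'
  have hT : ‖τ‖ ^ 2 ≤ ‖η‖ ^ 2 := by gcongr
  have hquot : ‖η'‖ ^ 2 / ⟪g', η'⟫ ^ 2 =
      ‖τ‖ ^ 2 / ⟪g, η⟫ ^ 2 + 1 / ‖g'‖ ^ 2 - ⟪g', τ⟫ ^ 2 / (‖g'‖ ^ 2 * ⟪g, η⟫ ^ 2) := by
    rw [hnorm, hinner, hβ]
    clear hinner hnorm hβ hη'
    generalize ⟪g', τ⟫ = c at *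
    generalize ⟪g, η⟫ = a at *
    generalize ‖g'‖ = G at *
    have ha : a ≠ 0 := hgη.ne
    have hD : c - a ≠ 0 := (sub_pos.mpr hτ).ne'
    have hden : -G ^ 2 + G ^ 2 / (c - a) * c = G ^ 2 * a / (c - a) := by
      field_simp
      ring
    rw [hden]
    field_simp
    ring
  rw [hquot]
  have hle : ‖τ‖ ^ 2 / ⟪g, η⟫ ^ 2 ≤ ‖η‖ ^ 2 / ⟪g, η⟫ ^ 2 := by gcongr
  have hnonneg : 0 ≤ ⟪g', τ⟫ ^ 2 / (‖g'‖ ^ 2 * ⟪g, η⟫ ^ 2) := by positivity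
  linarith
end

section
/- Under the hypotheses of Proposition 4.2 — (E_k)_{k≥0} real inner product spaces, 0 < c₂ < 1, g_k ∈ E_k nonzero, u_k ∈ E_{k+1} with ⟨g_{k+1}, u_k⟩ ≥ c₂⟨g_k, η_k⟩, η_0 = −g_0, τ_k = min{1, ‖η_k‖/‖u_k‖}·u_k, β_{k+1} = ‖g_{k+1}‖²/(⟨g_{k+1}, τ_k⟩ − ⟨g_k, η_k⟩), η_{k+1} = −g_{k+1} + β_{k+1}τ_k — it holds for every k ≥ 0 that ‖η_k‖² / ⟨g_k, η_k⟩² ≤ ∑_{i=0}^{k} 1/‖g_i‖². -/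
open RealInnerProductSpace

theorem norm_min_one_div_smul_le {F : Type*} [NormedAddCommGroup F] [NormedSpace ℝ F]
    {r : ℝ} (hr : 0 ≤ r) (u : F) : ‖min 1 (r / ‖u‖) • u‖ ≤ r := by
  have hs : 0 ≤ min 1 (r / ‖u‖) := le_min zero_le_one (by positivity)
  rw [norm_smul, Real.norm_of_nonneg hs]
  refine (mul_le_mul_of_nonneg_right (min_le_right _ _) (norm_nonneg u)).trans ?_
  rw [div_mul_eq_mul_div, mul_div_assoc]
  exact mul_le_of_le_one_right hr (div_self_le_one _)

/-- With the Dai–Yuan parameter, the new slope is the old one multiplied by that parameter. -/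
theorem inner_daiYuan_direction {F : Type*} [NormedAddCommGroup F] [InnerProductSpace ℝ F]
    {d : ℝ} (g τ : F) (h : ⟪g, τ⟫ - d ≠ 0) :
    ⟪g, -g + (‖g‖ ^ 2 / (⟪g, τ⟫ - d)) • τ⟫ = ‖g‖ ^ 2 / (⟪g, τ⟫ - d) * d := by
  rw [inner_add_right, inner_neg_right, inner_smul_right, real_inner_self_eq_norm_sq]
  field_simp
  ring

theorem norm_sq_div_inner_sq_le {F : Type*} [NormedAddCommGroup F] [InnerProductSpace ℝ F]
    {g τ : F} {b d r : ℝ} (hg : g ≠ 0) (hb : b ≠ 0) (hd : d ≠ 0) (hτ : ‖τ‖ ≤ r)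
    (h : ⟪g, -g + b • τ⟫ = b * d) :
    ‖-g + b • τ‖ ^ 2 / ⟪g, -g + b • τ⟫ ^ 2 ≤ r ^ 2 / d ^ 2 + 1 / ‖g‖ ^ 2 := by
  have hG : ‖g‖ ≠ 0 := norm_ne_zero_iff.mpr hg
  have hnorm : ‖-g + b • τ‖ ^ 2 = b ^ 2 * ‖τ‖ ^ 2 - 2 * (b * d) - ‖g‖ ^ 2 := by
    have h₁ : ‖b • τ‖ ^ 2 = b ^ 2 * ‖τ‖ ^ 2 := by
      rw [norm_smul, mul_pow, Real.norm_eq_abs, sq_abs]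
    have h₂ := norm_add_sq_real g (-g + b • τ)
    rw [add_neg_cancel_left, h₁, h] at h₂
    linarith
  rw [h, hnorm]
  have hsplit : (b ^ 2 * ‖τ‖ ^ 2 - 2 * (b * d) - ‖g‖ ^ 2) / (b * d) ^ 2 =
      ‖τ‖ ^ 2 / d ^ 2 + 1 / ‖g‖ ^ 2 - (‖g‖ / (b * d) + 1 / ‖g‖) ^ 2 := by
    field_simp
    ring
  have hle : ‖τ‖ ^ 2 / d ^ 2 ≤ r ^ 2 / d ^ 2 := by gcongr
  rw [hsplit]
  linarith [sq_nonneg (‖g‖ / (b * d) + 1 / ‖g‖)]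

/-- Inequality (46) in the global convergence proof:
‖η_k‖²/⟪g_k,η_k⟫² ≤ ∑_{i=0}^{k} 1/‖g_i‖². -/
theorem scaled_dai_yuan_direction_bound
    {E : ℕ → Type*} [∀ k, NormedAddCommGroup (E k)] [∀ k, InnerProductSpace ℝ (E k)]
    (c₂ : ℝ) (hc₂0 : 0 < c₂) (hc₂1 : c₂ < 1)
    (g : ∀ k, E k) (hg : ∀ k, g k ≠ 0)
    (u : ∀ k, E (k + 1)) (η : ∀ k, E k) (τ : ∀ k, E (k + 1)) (β : ℕ → ℝ)
    (hη0 : η 0 = -g 0)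
    (hτ : ∀ k, τ k = min 1 (‖η k‖ / ‖u k‖) • u k)
    (hβ : ∀ k, β (k + 1) = ‖g (k + 1)‖ ^ 2 / (⟪g (k + 1), τ k⟫ - ⟪g k, η k⟫))
    (hη : ∀ k, η (k + 1) = -g (k + 1) + β (k + 1) • τ k)
    (hcurv : ∀ k, ⟪g (k + 1), u k⟫ ≥ c₂ * ⟪g k, η k⟫) :
    ∀ k, ‖η k‖ ^ 2 / ⟪g k, η k⟫ ^ 2 ≤ ∑ i ∈ Finset.range (k + 1), 1 / ‖g i‖ ^ 2 := by
  have hden : ∀ k, ⟪g k, η k⟫ < 0 → 0 < ⟪g (k + 1), τ k⟫ - ⟪g k, η k⟫ := by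
    intro k hk
    rw [hτ k, inner_smul_right]
    set s := min 1 (‖η k‖ / ‖u k‖)
    have hs0 : 0 ≤ s := le_min zero_le_one (by positivity)
    have hs1 : s ≤ 1 := min_le_left _ _
    have h₁ := mul_le_mul_of_nonneg_left (hcurv k) hs0
    have h₂ : s * c₂ < 1 := (mul_le_of_le_one_left hc₂0.le hs1).trans_lt hc₂1
    nlinarith [mul_neg_of_pos_of_neg (sub_pos.mpr h₂) hk]
  have hβpos : ∀ k, ⟪g k, η k⟫ < 0 → 0 < β (k + 1) := by
    intro k hk
    rw [hβ k]
    exact div_pos (pow_pos (norm_pos_iff.mpr (hg _)) 2) (hden k hk)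
  have hslope : ∀ k, ⟪g k, η k⟫ < 0 →
      ⟪g (k + 1), -g (k + 1) + β (k + 1) • τ k⟫ = β (k + 1) * ⟪g k, η k⟫ := by
    intro k hk
    rw [hβ k]
    exact inner_daiYuan_direction _ _ (hden k hk).ne'
  have hdesc : ∀ k, ⟪g k, η k⟫ < 0 := by
    intro k
    induction k with
    | zero =>
      rw [hη0, inner_neg_right, neg_lt_zero]
      exact real_inner_self_pos.mpr (hg 0)
    | succ k ih =>
      rw [hη k, hslope k ih]
      exact mul_neg_of_pos_of_neg (hβpos k ih) ih
  intro k
  induction k with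
  | zero =>
    have hG : ‖g 0‖ ≠ 0 := norm_ne_zero_iff.mpr (hg 0)
    rw [hη0, inner_neg_right, norm_neg, real_inner_self_eq_norm_sq, zero_add,
      Finset.sum_range_one]
    apply le_of_eq
    field_simp
  | succ k ih =>
    have hτle : ‖τ k‖ ≤ ‖η k‖ := by
      rw [hτ k]
      exact norm_min_one_div_smul_le (norm_nonneg _) _
    rw [Finset.sum_range_succ, hη k]
    exact (norm_sq_div_inner_sq_le (hg _) (hβpos k (hdesc k)).ne' (hdesc k).ne hτle
      (hslope k (hdesc k))).trans (by gcongr)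
end

section
/- Let (E_k)_{k≥0} be a family of real inner product spaces and let g_k, η_k ∈ E_k with g_k ≠ 0 and ⟨g_k, η_k⟩ ≠ 0 for all k. Suppose that ‖η_k‖² / ⟨g_k, η_k⟩² ≤ ∑_{i=0}^{k} 1/‖g_i‖² for every k, and that ∑_{k=0}^∞ ⟨g_k, η_k⟩² / ‖η_k‖² < ∞. Then liminf_{k→∞} ‖g_k‖ = 0. -/
open RealInnerProductSpace

/-- If a sequence `a` is eventually bounded away from zero, then a positive sequence `t`
with `(t k)⁻¹ ≤ ∑ i ≤ k, 1 / a i ^ 2` is not summable. -/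
theorem not_summable_of_inv_le_sum_of_eventually_le {a t : ℕ → ℝ} (ht : ∀ k, 0 < t k)
    (hbound : ∀ k, (t k)⁻¹ ≤ ∑ i ∈ Finset.range (k + 1), 1 / a i ^ 2)
    {c : ℝ} (hc : 0 < c) (hev : ∀ᶠ k in Filter.atTop, c ≤ a k) : ¬ Summable t := by
  intro hsum
  have hbdd : Filter.IsBoundedUnder (· ≤ ·) Filter.atTop (fun k => 1 / a k ^ 2) := by
    refine ⟨1 / c ^ 2, Filter.eventually_map.2 ?_⟩
    filter_upwards [hev] with k hk
    gcongr
  obtain ⟨B, hB⟩ := hbdd.bddAbove_range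
  have hle : ∀ k, (t k)⁻¹ ≤ ((k : ℝ) + 1) * B := fun k => by
    refine (hbound k).trans ?_
    have h := Finset.sum_le_card_nsmul (Finset.range (k + 1)) (fun i => 1 / a i ^ 2) B
      fun i _ => hB ⟨i, rfl⟩
    simpa using h
  have hBpos : 0 < B := by
    have h := (inv_pos.2 (ht 0)).trans_le (hle 0)
    simpa using h
  have hharm : Summable fun k : ℕ => 1 / ((k : ℝ) + 1) := by
    refine Summable.of_nonneg_of_le (fun k => by positivity) (fun k => ?_) (hsum.mul_left B)
    have h := mul_le_mul_of_nonneg_right (hle k) (ht k).le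
    rw [inv_mul_cancel₀ (ht k).ne'] at h
    rw [div_le_iff₀ (by positivity)]
    linarith
  refine Real.not_summable_one_div_natCast ((summable_nat_add_iff 1).1 ?_)
  simpa using hharm

/-- The concluding contradiction argument of the global convergence theorem:
the direction bound together with the Zoutendijk summability forces
liminf ‖g_k‖ = 0. -/
theorem liminf_grad_zero_of_bounds
    {E : ℕ → Type*} [∀ k, NormedAddCommGroup (E k)] [∀ k, InnerProductSpace ℝ (E k)]
    (g η : ∀ k, E k)
    (hg : ∀ k, g k ≠ 0) (hgη : ∀ k, ⟪g k, η k⟫ ≠ 0)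
    (hbound : ∀ k, ‖η k‖ ^ 2 / ⟪g k, η k⟫ ^ 2 ≤ ∑ i ∈ Finset.range (k + 1), 1 / ‖g i‖ ^ 2)
    (hsum : Summable (fun k => ⟪g k, η k⟫ ^ 2 / ‖η k‖ ^ 2)) :
    Filter.liminf (fun k => ‖g k‖) Filter.atTop = 0 := by
  have hη : ∀ k, 0 < ‖η k‖ := fun k => norm_pos_iff.2 fun h => hgη k (by rw [h, inner_zero_right])
  have ht : ∀ k, 0 < ⟪g k, η k⟫ ^ 2 / ‖η k‖ ^ 2 := fun k =>
    div_pos (sq_pos_of_ne_zero (hgη k)) (pow_pos (hη k) 2)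
  rw [Filter.liminf_eq]
  refine IsGreatest.csSup_eq ⟨Filter.Eventually.of_forall fun k => norm_nonneg _, fun c hc => ?_⟩
  by_contra! hpos
  exact not_summable_of_inv_le_sum_of_eventually_le ht
    (fun k => by rw [inv_div]; exact hbound k) hpos hc hsum
end
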